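/- The Option (Maybe) monad distributes over the Giry monad of measures: equip Option α, for a measurable space α, with the σ-algebra under which some : α → Option α is a measurable embedding and {none} is measurable. Define l : Option (Measure X) → Measure (Option X) by l (some μ) = Measure.map some μ and l none = Measure.dirac none. Then (a) l is a measurable function (where Measure carries the Giry σ-algebra generated by evaluation on measurable sets); (b) l is natural: for every measurable f : X → Y and o : Option (Measure X), l (Option.map (Measure.map f) o) = Measure.map (Option.map f) (l o); (c) for every o : Option X, l (Option.map Measure.dirac o) = Measure.dirac o; (d) for every μ : Measure X, l (some μ) = Measure.map some μ; (e) for every q : Option (Option (Measure X)), l (Option.join q) = Measure.map Option.join (l (Option.map l q)); and (f) for every q : Option (Measure (Measure X)), l (Option.map Measure.join q) = Measure.join (Measure.map l (l q)). Hence l satisfies the Beck axioms of a distributive law between the Giry monad and the Maybe monad, exhibiting Panangaden's subprobability monad X ↦ Measure (Option X) as their composite. -/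

import Mathlib

open MeasureTheory

/-- The σ-algebra on `Option X` generated by pushing forward along
`some`: a set is measurable iff its preimage under `some` is measurable.
Under this σ-algebra `some` is a measurable embedding and `{none}` is
measurable. -/
instance optionMeasurableSpace {X : Type*} [m : MeasurableSpace X] :
    MeasurableSpace (Option X) :=
  m.map some

/-- The candidate distributive law of the Maybe monad over the Giry monad:
`some μ ↦ μ.map some` and `none ↦ dirac none`. -/
noncomputable def giryDistLaw {X : Type*} [MeasurableSpace X] :
    Option (Measure X) → Measure (Option X)
  | some μ => μ.map some
  | none => Measure.dirac none

theorem measurable_option_iff {X Z : Type*} [MeasurableSpace X] [MeasurableSpace Z]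
    {g : Option X → Z} : Measurable g ↔ Measurable fun x => g (some x) :=
  Iff.rfl

theorem measurable_option_some {X : Type*} [MeasurableSpace X] :
    Measurable (some : X → Option X) :=
  fun _ hs => hs

theorem measurableEmbedding_option_some {X : Type*} [MeasurableSpace X] :
    MeasurableEmbedding (some : X → Option X) where
  injective := Option.some_injective X
  measurable := measurable_option_some
  measurableSet_image' s hs := by
    change MeasurableSet (some ⁻¹' (some '' s))
    rwa [Set.preimage_image_eq _ (Option.some_injective X)]

theorem measurableSet_option_none {X : Type*} [MeasurableSpace X] :
    MeasurableSet ({none} : Set (Option X)) := by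
  change MeasurableSet (some ⁻¹' {none})
  have h : (some ⁻¹' {none} : Set X) = ∅ := by ext; simp
  rw [h]
  exact MeasurableSet.empty

theorem measurable_option_map {X Y : Type*} [MeasurableSpace X] [MeasurableSpace Y]
    {f : X → Y} (hf : Measurable f) : Measurable (Option.map f) :=
  measurable_option_iff.2 (measurable_option_some.comp hf)

theorem measurable_option_join {X : Type*} [MeasurableSpace X] :
    Measurable (Option.join : Option (Option X) → Option X) :=
  measurable_option_iff.2 measurable_id

theorem measurable_giryDistLaw {X : Type*} [MeasurableSpace X] :
    Measurable (giryDistLaw : Option (Measure X) → Measure (Option X)) :=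
  measurable_option_iff.2 (Measure.measurable_map some measurable_option_some)

/-- The Maybe monad distributes over the Giry monad: `giryDistLaw` is a
measurable natural transformation satisfying the Beck axioms of a distributive
law, exhibiting Panangaden's subprobability monad `X ↦ Measure (Option X)` as
the composite monad. -/
theorem giryDistLaw_beck {X Y : Type*} [MeasurableSpace X] [MeasurableSpace Y] :
    (MeasurableEmbedding (some : X → Option X)) ∧
    (MeasurableSet ({none} : Set (Option X))) ∧
    (Measurable (giryDistLaw : Option (Measure X) → Measure (Option X))) ∧
    (∀ f : X → Y, Measurable f → ∀ o : Option (Measure X),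
      giryDistLaw (Option.map (Measure.map f) o)
        = Measure.map (Option.map f) (giryDistLaw o)) ∧
    (∀ o : Option X, giryDistLaw (Option.map Measure.dirac o) = Measure.dirac o) ∧
    (∀ μ : Measure X, giryDistLaw (some μ) = μ.map some) ∧
    (∀ q : Option (Option (Measure X)),
      giryDistLaw (Option.join q)
        = Measure.map Option.join (giryDistLaw (Option.map giryDistLaw q))) ∧
    (∀ q : Option (Measure (Measure X)),
      giryDistLaw (Option.map Measure.join q)
        = Measure.join (Measure.map giryDistLaw (giryDistLaw q))) := by
  refine ⟨measurableEmbedding_option_some, measurableSet_option_none, measurable_giryDistLaw,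
    ?_, ?_, fun _ => rfl, ?_, ?_⟩
  · rintro f hf (_ | μ)
    · exact (Measure.map_dirac' (measurable_option_map hf) none).symm
    · change (μ.map f).map some = (μ.map some).map (Option.map f)
      rw [Measure.map_map measurable_option_some hf,
        Measure.map_map (measurable_option_map hf) measurable_option_some]
      rfl
  · rintro (_ | x)
    · rfl
    · exact Measure.map_dirac' measurable_option_some x
  · rintro (_ | _ | μ)
    · exact (Measure.map_dirac' measurable_option_join none).symm
    · change Measure.dirac none = ((Measure.dirac none).map some).map Option.join
      rw [Measure.map_dirac' measurable_option_some, Measure.map_dirac' measurable_option_join]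
      rfl
    · change μ.map some = ((μ.map some).map some).map Option.join
      rw [Measure.map_map measurable_option_join measurable_option_some]
      exact Measure.map_id.symm
  · rintro (_ | m)
    · change Measure.dirac none = ((Measure.dirac none).map giryDistLaw).join
      rw [Measure.map_dirac' measurable_giryDistLaw, Measure.join_dirac]
      rfl
    · change m.join.map some = ((m.map some).map giryDistLaw).join
      rw [Measure.map_map measurable_giryDistLaw measurable_option_some]
      exact (Measure.join_map_map measurable_option_some m).symm
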